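/- For every α ∈ [0,1] and every ρ > 0 there exists a constant C > 0 such that the following holds. Let 𝒫 be a finite set of m points in 𝕊² and let ℒ be a finite set of n lines in 𝕊², where each line of ℒ is defined by an equation of the form y = ax + b (with a, b ∈ 𝕊) or of the form x = b (with b ∈ 𝕊), and where for every r ∈ ℝ at most n^α lines of ℒ of the form y = ax + b satisfy Δ⁺(a) = r and at most n^α such lines satisfy Δ⁻(a) = r. Then the number of incidences satisfies I(𝒫,ℒ) ≤ C·(m^{2/3+ρ}·n^{(2+α)/3} + m·n^α + n). -/

import Mathlib

open Pointwise

/-- The double (split-complex) numbers `ℝ[j]` with `j² = 1`: the number `a = a₁ + j a₂`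
is recorded by its coordinates `re = a₁` and `im = a₂`. -/
@[ext] structure DoubleNumber where
  re : ℝ
  im : ℝ

namespace DoubleNumber

noncomputable instance : DecidableEq DoubleNumber := Classical.decEq _

/-- Addition of double numbers: componentwise. -/
instance : Add DoubleNumber := ⟨fun a b => ⟨a.re + b.re, a.im + b.im⟩⟩

/-- Multiplication of double numbers, determined by `j² = 1`:
`(a₁ + j a₂)(b₁ + j b₂) = (a₁b₁ + a₂b₂) + j (a₁b₂ + a₂b₁)`. -/
instance : Mul DoubleNumber := ⟨fun a b => ⟨a.re * b.re + a.im * b.im, a.re * b.im + a.im * b.re⟩⟩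

/-- `Δ⁺(a₁ + j a₂) = a₁ + a₂`. -/
def dplus (a : DoubleNumber) : ℝ := a.re + a.im

/-- `Δ⁻(a₁ + j a₂) = a₁ - a₂`. -/
def dminus (a : DoubleNumber) : ℝ := a.re - a.im

end DoubleNumber

attribute [local instance] Classical.propDecidable

/-- A line in the double plane `𝕊²`, given either by an equation `y = a x + b`
(with `a, b ∈ 𝕊`) or by an equation `x = b` (with `b ∈ 𝕊`). -/
inductive DoubleLine where
  | slope (a b : DoubleNumber) : DoubleLine
  | vert (b : DoubleNumber) : DoubleLine

/-- The set of points of `𝕊²` lying on a line. -/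
def DoubleLine.pts : DoubleLine → Set (DoubleNumber × DoubleNumber)
  | .slope a b => {p | p.2 = a * p.1 + b}
  | .vert b => {p | p.1 = b}

/-- `Δ⁺` of the slope coefficient `a` of a line `y = a x + b`
(and `none` for a line `x = b`). -/
def DoubleLine.slopeDplus : DoubleLine → Option ℝ
  | .slope a _ => some a.dplus
  | .vert _ => none

/-- `Δ⁻` of the slope coefficient `a` of a line `y = a x + b`
(and `none` for a line `x = b`). -/
def DoubleLine.slopeDminus : DoubleLine → Option ℝ
  | .slope a _ => some a.dminus
  | .vert _ => none

/-- The number of incidences `I(𝒫, ℒ)`: the number of pairs `(p, ℓ) ∈ 𝒫 × ℒ` with `p ∈ ℓ`. -/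
noncomputable def inc (P : Finset (DoubleNumber × DoubleNumber)) (L : Finset DoubleLine) : ℕ :=
  ((P ×ˢ L).filter fun pl => pl.1 ∈ pl.2.pts).card

/-- An affine function positive at `x` and negative at `y` vanishes strictly in between. -/
theorem affine_zero_right {A B x y : ℝ} (hxy : x < y) (hx : 0 < A * x + B) (hy : A * y + B < 0) :
    ∃ z, x < z ∧ z < y ∧ A * z + B = 0 := by
  have hA : A < 0 := by nlinarith
  refine ⟨-B / A, ?_, ?_, ?_⟩
  · rw [lt_div_iff_of_neg hA]; linarith
  · rw [div_lt_iff_of_neg hA]; linarith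
  · rw [mul_div_cancel₀ _ hA.ne]; ring

theorem affine_cross {a b c d x y : ℝ} (hxy : x < y) (hx : c * x + d < a * x + b)
    (hy : a * y + b < c * y + d) : ∃ z, x < z ∧ z < y ∧ a * z + b = c * z + d := by
  obtain ⟨z, h1, h2, h3⟩ := affine_zero_right (A := a - c) (B := b - d) hxy
    (by linarith) (by linarith)
  exact ⟨z, h1, h2, by linarith⟩

/-- A straight-line plane graph on `S` has at most `3 |S|` edges. -/
theorem plane_edges {ι : Type*} (E : Finset ι) (S : Finset (ℝ × ℝ)) (a b l r : ι → ℝ)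
    (hlr : ∀ e ∈ E, l e < r e)
    (hL : ∀ e ∈ E, (l e, a e * l e + b e) ∈ S)
    (hR : ∀ e ∈ E, (r e, a e * r e + b e) ∈ S)
    (hv : ∀ e ∈ E, ∀ w ∈ S, l e < w.1 → w.1 < r e → w.2 ≠ a e * w.1 + b e)
    (hc : ∀ e ∈ E, ∀ f ∈ E, e ≠ f → ∀ x, l e < x → x < r e → l f < x → x < r f →
      a e * x + b e ≠ a f * x + b f) : E.card ≤ 3 * S.card := by
  set E1 := E.filter (fun e => ∀ f ∈ E, l f = l e → a f * l f + b f = a e * l e + b e →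
    a f ≤ a e) with hE1
  set E2 := E.filter (fun e => ∀ f ∈ E, r f = r e → a f * r f + b f = a e * r e + b e →
    a e ≤ a f) with hE2
  set E3 := E.filter (fun e => e ∉ E1 ∧ e ∉ E2) with hE3
  have hsub : E ⊆ E1 ∪ (E2 ∪ E3) := by
    intro e he
    simp only [Finset.mem_union]
    by_cases h1 : e ∈ E1
    · exact Or.inl h1
    by_cases h2 : e ∈ E2
    · exact Or.inr (Or.inl h2)
    · exact Or.inr (Or.inr (Finset.mem_filter.2 ⟨he, h1, h2⟩))
  have c1 : E1.card ≤ S.card := by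
    refine Finset.card_le_card_of_injOn (fun e => (l e, a e * l e + b e)) ?_ ?_
    · intro e he
      exact hL e (Finset.mem_filter.1 he).1
    · intro e he f hf hef
      obtain ⟨he, he'⟩ := Finset.mem_filter.1 he
      obtain ⟨hf, hf'⟩ := Finset.mem_filter.1 hf
      simp only [Prod.mk.injEq] at hef
      obtain ⟨h1, h2⟩ := hef
      have ha : a e = a f := le_antisymm (hf' e he h1 h2) (he' f hf h1.symm h2.symm)
      by_contra hne
      have hb : b e = b f := by rw [ha, h1] at h2; linarith
      obtain ⟨z, hz1, hz2⟩ := exists_between (lt_min (hlr e he) (h1 ▸ hlr f hf : l e < r f))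
      exact hc e he f hf hne z hz1 (lt_of_lt_of_le hz2 (min_le_left _ _)) (h1 ▸ hz1)
        (lt_of_lt_of_le hz2 (min_le_right _ _)) (by rw [ha, hb])
  have c2 : E2.card ≤ S.card := by
    refine Finset.card_le_card_of_injOn (fun e => (r e, a e * r e + b e)) ?_ ?_
    · intro e he
      exact hR e (Finset.mem_filter.1 he).1
    · intro e he f hf hef
      obtain ⟨he, he'⟩ := Finset.mem_filter.1 he
      obtain ⟨hf, hf'⟩ := Finset.mem_filter.1 hf
      simp only [Prod.mk.injEq] at hef
      obtain ⟨h1, h2⟩ := hef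
      have ha : a e = a f := le_antisymm (he' f hf h1.symm h2.symm) (hf' e he h1 h2)
      by_contra hne
      have hb : b e = b f := by rw [ha, h1] at h2; linarith
      obtain ⟨z, hz1, hz2⟩ := exists_between (max_lt (hlr e he) (h1 ▸ hlr f hf : l f < r e))
      exact hc e he f hf hne z (lt_of_le_of_lt (le_max_left _ _) hz1) hz2
        (lt_of_le_of_lt (le_max_right _ _) hz1) (h1 ▸ hz2) (by rw [ha, hb])
  have key : ∀ e ∈ E3, ∃ w ∈ S, l e < w.1 ∧ w.1 < r e ∧ a e * w.1 + b e < w.2 ∧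
      ∀ k ∈ E, l k < w.1 → w.1 < r k → a k * w.1 + b k < w.2 →
        a k * w.1 + b k ≤ a e * w.1 + b e := by
    intro e he
    obtain ⟨he, hn1, hn2⟩ := Finset.mem_filter.1 he
    have hF : (E.filter (fun f => l f = l e ∧ a f * l f + b f = a e * l e + b e ∧
        a e < a f)).Nonempty := by
      by_contra h
      rw [Finset.not_nonempty_iff_eq_empty, Finset.filter_eq_empty_iff] at h
      apply hn1
      refine Finset.mem_filter.2 ⟨he, fun f hf h1 h2 => ?_⟩
      by_contra h3
      exact h hf ⟨h1, h2, not_le.1 h3⟩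
    obtain ⟨f, hf, hfmin⟩ := Finset.exists_min_image _ a hF
    obtain ⟨hf, hfl, hfu, hfa⟩ := Finset.mem_filter.1 hf
    have hG : ∃ g ∈ E, r g = r e ∧ a g * r g + b g = a e * r e + b e ∧ a g < a e := by
      by_contra h
      push Not at h
      apply hn2
      exact Finset.mem_filter.2 ⟨he, fun g hg h1 h2 => h g hg h1 h2⟩
    obtain ⟨g, hg, hgr, hgv, hga⟩ := hG
    rw [hfl] at hfu
    rw [hgr] at hgv
    have fe : ∀ x, l e < x → a e * x + b e < a f * x + b f := by
      intro x hx; nlinarith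
    have ge : ∀ x, x < r e → a e * x + b e < a g * x + b g := by
      intro x hx; nlinarith
    have hgf : g ≠ f := by rintro rfl; linarith
    have hle := hlr e he
    set B := S.filter (fun w => l e < w.1 ∧ w.1 < r e ∧ a e * w.1 + b e < w.2 ∧
      w.2 ≤ a f * w.1 + b f ∧ w.1 ≤ r f) with hB
    have hBne : B.Nonempty := by
      by_cases h1 : r f < r e
      · refine ⟨(r f, a f * r f + b f), Finset.mem_filter.2 ⟨hR f hf, ?_, h1, ?_, le_rfl, le_rfl⟩⟩
        · exact hfl ▸ hlr f hf
        · exact fe _ (hfl ▸ hlr f hf)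
      · rw [not_lt] at h1
        have h2 := fe _ hle
        by_cases h3 : l e < l g
        · refine ⟨(l g, a g * l g + b g), Finset.mem_filter.2 ⟨hL g hg, h3, ?_, ?_, ?_, ?_⟩⟩
          · exact hgr ▸ hlr g hg
          · exact ge _ (hgr ▸ hlr g hg)
          · by_contra h4
            rw [not_le] at h4
            have h5 : l g < r e := hgr ▸ hlr g hg
            obtain ⟨z, z1, z2, z3⟩ := affine_cross h5 h4 (by linarith)
            exact hc g hg f hf hgf z z1 (hgr ▸ z2) (by rw [hfl]; linarith) (by linarith) z3
          · have h5 : l g < r e := hgr ▸ hlr g hg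
            show l g ≤ r f
            linarith
        · rw [not_lt] at h3
          exfalso
          have h4 := ge _ hle
          obtain ⟨z, z1, z2, z3⟩ := affine_cross (a := a g) (b := b g) (c := a f) (d := b f) hle
            (by linarith) (by linarith)
          exact hc g hg f hf hgf z (by linarith) (by linarith) (by linarith) (by linarith) z3
    obtain ⟨w, hw, hwmin⟩ := Finset.exists_min_image B (fun w => w.1) hBne
    obtain ⟨hwS, w1, w2, w3, w4, w5⟩ := Finset.mem_filter.1 hw
    refine ⟨w, hwS, w1, w2, w3, ?_⟩
    intro k hk k1 k2 k3
    by_contra k4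
    rw [not_le] at k4
    have hke : k ≠ e := by rintro rfl; exact lt_irrefl _ k4
    have hkf : k ≠ f := by rintro rfl; linarith
    by_cases h1 : l e < l k
    · have : (l k, a k * l k + b k) ∈ B := by
        refine Finset.mem_filter.2 ⟨hL k hk, h1, by show l k < r e; linarith, ?_, ?_,
          by show l k ≤ r f; linarith⟩
        · show a e * l k + b e < a k * l k + b k
          rcases lt_trichotomy (a e * l k + b e) (a k * l k + b k) with h | h | h
          · exact h
          · exact absurd h.symm (hv e he _ (hL k hk) h1 (by show l k < r e; linarith))
          · obtain ⟨z, z1, z2, z3⟩ := affine_cross k1 h k4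
            exact absurd z3 (hc e he k hk hke.symm z (by linarith) (by linarith) (by linarith)
              (by linarith))
        · show a k * l k + b k ≤ a f * l k + b f
          by_contra h
          rw [not_le] at h
          obtain ⟨z, z1, z2, z3⟩ := affine_cross (a := a k) (b := b k) (c := a f) (d := b f)
            k1 h (by linarith)
          exact absurd z3 (hc k hk f hf hkf z (by linarith) (by linarith) (by linarith)
              (by linarith))
      have := hwmin _ this
      simp only at this
      linarith
    · rw [not_lt] at h1
      have heq : a e * l e + b e = a k * l e + b k := by
        rcases lt_trichotomy (a e * l e + b e) (a k * l e + b k) with h | h | h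
        · obtain ⟨z, z1, z2, z3⟩ := affine_cross (a := a k) (b := b k) (c := a f) (d := b f)
            w1 (by linarith) (by linarith)
          exact absurd z3 (hc k hk f hf hkf z (by linarith) (by linarith) (by linarith)
              (by linarith))
        · exact h
        · obtain ⟨z, z1, z2, z3⟩ := affine_cross w1 h k4
          exact absurd z3 (hc e he k hk hke.symm z (by linarith) (by linarith) (by linarith)
              (by linarith))
      rcases h1.lt_or_eq with h2 | h2
      · exact hv k hk _ (hL e he) h2 (by show l e < r k; linarith) heq
      · have hak : a e < a k := by nlinarith
        have := hfmin k (Finset.mem_filter.2 ⟨hk, h2, by rw [h2]; exact heq.symm, hak⟩)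
        nlinarith
  have c3 : E3.card ≤ S.card := by
    choose! w hwS hw1 hw2 hw3 hw4 using key
    refine Finset.card_le_card_of_injOn w (fun e he => hwS e he) ?_
    intro e he f hf hef
    have he0 := (Finset.mem_filter.1 he).1
    have hf0 := (Finset.mem_filter.1 hf).1
    have e1 := hw1 e he
    have e2 := hw2 e he
    have e3 := hw3 e he
    have e4 := hw4 e he
    have f1 := hw1 f hf
    have f2 := hw2 f hf
    have f3 := hw3 f hf
    have f4 := hw4 f hf
    rw [hef] at e1 e2 e3 e4
    by_contra hne
    exact hc e he0 f hf0 hne _ e1 e2 f1 f2 (le_antisymm (f4 e he0 e1 e2 e3) (e4 f hf0 f1 f2 f3))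
  calc E.card ≤ (E1 ∪ (E2 ∪ E3)).card := Finset.card_le_card hsub
    _ ≤ E1.card + (E2 ∪ E3).card := Finset.card_union_le _ _
    _ ≤ E1.card + (E2.card + E3.card) := by gcongr; exact Finset.card_union_le _ _
    _ ≤ 3 * S.card := by omega

/-- Averaging over random subsets: weights. -/
theorem weight_superset {V : Type*} (P A : Finset V) (hA : A ⊆ P) (p : ℝ) :
    ∑ T ∈ P.powerset, (if A ⊆ T then p ^ T.card * (1 - p) ^ (P \ T).card else 0) = p ^ A.card := by
  have h := Finset.prod_add (fun _ : V => p) (fun i : V => if i ∈ A then 0 else 1 - p) P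
  have h1 : ∏ i ∈ P, (p + if i ∈ A then 0 else 1 - p) = p ^ A.card := by
    have : ∀ i ∈ P, (p + if i ∈ A then 0 else 1 - p) = if i ∈ A then p else 1 := by
      intro i _
      split_ifs <;> ring
    rw [Finset.prod_congr rfl this, Finset.prod_ite_mem, Finset.inter_eq_right.2 hA,
      Finset.prod_const]
  rw [← h1, h]
  refine Finset.sum_congr rfl fun T hT => ?_
  rw [Finset.prod_const]
  split_ifs with hAT
  · congr 1
    rw [← Finset.prod_const]
    refine Finset.prod_congr rfl fun i hi => ?_
    rw [if_neg]
    intro hiA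
    exact (Finset.mem_sdiff.1 hi).2 (hAT hiA)
  · obtain ⟨i, hiA, hiT⟩ := Finset.not_subset.1 hAT
    rw [Finset.prod_eq_zero (Finset.mem_sdiff.2 ⟨hA hiA, hiT⟩) (by simp [hiA]), mul_zero]

theorem weight_count {V I : Type*} (P : Finset V) (J : Finset I) (sup : I → Finset V)
    (hs : ∀ i ∈ J, sup i ⊆ P) (p : ℝ) :
    ∑ T ∈ P.powerset, p ^ T.card * (1 - p) ^ (P \ T).card *
      ((J.filter fun i => sup i ⊆ T).card : ℝ) = ∑ i ∈ J, p ^ (sup i).card := by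
  have : ∀ i ∈ J, p ^ (sup i).card =
      ∑ T ∈ P.powerset, (if sup i ⊆ T then p ^ T.card * (1 - p) ^ (P \ T).card else 0) :=
    fun i hi => (weight_superset P (sup i) (hs i hi) p).symm
  rw [Finset.sum_congr rfl this, Finset.sum_comm]
  refine Finset.sum_congr rfl fun T _ => ?_
  rw [← Finset.sum_filter, Finset.sum_const, nsmul_eq_mul, mul_comm]

/-- Edges of the incidence graph: consecutive points of `P` on a line of `L`. -/
noncomputable def stEdges (P L : Finset (ℝ × ℝ)) : Finset ((ℝ × ℝ) × (ℝ × ℝ) × (ℝ × ℝ)) :=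
  (L ×ˢ P ×ˢ P).filter fun e => e.2.1.2 = e.1.1 * e.2.1.1 + e.1.2 ∧
    e.2.2.2 = e.1.1 * e.2.2.1 + e.1.2 ∧ e.2.1.1 < e.2.2.1 ∧
    ∀ w ∈ P, e.2.1.1 < w.1 → w.1 < e.2.2.1 → w.2 ≠ e.1.1 * w.1 + e.1.2

/-- Two edges cross. -/
def stCross (e f : (ℝ × ℝ) × (ℝ × ℝ) × (ℝ × ℝ)) : Prop :=
  e ≠ f ∧ ∃ x, e.2.1.1 < x ∧ x < e.2.2.1 ∧ f.2.1.1 < x ∧ x < f.2.2.1 ∧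
    e.1.1 * x + e.1.2 = f.1.1 * x + f.1.2

theorem mem_stEdges {P L : Finset (ℝ × ℝ)} {e : (ℝ × ℝ) × (ℝ × ℝ) × (ℝ × ℝ)} :
    e ∈ stEdges P L ↔ (e.1 ∈ L ∧ e.2.1 ∈ P ∧ e.2.2 ∈ P) ∧ e.2.1.2 = e.1.1 * e.2.1.1 + e.1.2 ∧
    e.2.2.2 = e.1.1 * e.2.2.1 + e.1.2 ∧ e.2.1.1 < e.2.2.1 ∧
    ∀ w ∈ P, e.2.1.1 < w.1 → w.1 < e.2.2.1 → w.2 ≠ e.1.1 * w.1 + e.1.2 := by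
  simp only [stEdges, Finset.mem_filter, Finset.mem_product]

theorem stEdges_same {P L : Finset (ℝ × ℝ)} {e f : (ℝ × ℝ) × (ℝ × ℝ) × (ℝ × ℝ)}
    (he : e ∈ stEdges P L) (hf : f ∈ stEdges P L) (h : e.1 = f.1) {x : ℝ}
    (h1 : e.2.1.1 < x) (h2 : x < e.2.2.1) (h3 : f.2.1.1 < x) (h4 : x < f.2.2.1) : e = f := by
  obtain ⟨⟨eL, eP, eQ⟩, e1, e2, e3, e4⟩ := mem_stEdges.1 he
  obtain ⟨⟨fL, fP, fQ⟩, f1, f2, f3, f4⟩ := mem_stEdges.1 hf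
  rw [h] at e1 e2 e4
  have hl : e.2.1.1 = f.2.1.1 := by
    rcases lt_trichotomy e.2.1.1 f.2.1.1 with g | g | g
    · exact absurd f1 (e4 _ fP g (by linarith))
    · exact g
    · exact absurd e1 (f4 _ eP g (by linarith))
  have hr : e.2.2.1 = f.2.2.1 := by
    rcases lt_trichotomy e.2.2.1 f.2.2.1 with g | g | g
    · exact absurd e2 (f4 _ eQ (by linarith) g)
    · exact g
    · exact absurd f2 (e4 _ fQ (by linarith) g)
  refine Prod.ext h (Prod.ext (Prod.ext hl ?_) (Prod.ext hr ?_))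
  · rw [e1, f1, hl]
  · rw [e2, f2, hr]

theorem line_eq_of_two {k l : ℝ × ℝ} {x y : ℝ} (hxy : x ≠ y)
    (h1 : k.1 * x + k.2 = l.1 * x + l.2) (h2 : k.1 * y + k.2 = l.1 * y + l.2) : k = l := by
  have h : (k.1 - l.1) * (x - y) = 0 := by linarith
  rcases mul_eq_zero.1 h with h | h
  · refine Prod.ext (by linarith) ?_
    have : k.1 = l.1 := by linarith
    rw [this] at h1; linarith
  · exact absurd (by linarith) hxy

/-- The four endpoints of an edge pair. -/
noncomputable def stSup (c : ((ℝ × ℝ) × (ℝ × ℝ) × (ℝ × ℝ)) × ((ℝ × ℝ) × (ℝ × ℝ) × (ℝ × ℝ))) :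
    Finset (ℝ × ℝ) := {c.1.2.1, c.1.2.2, c.2.2.1, c.2.2.2}

theorem stCross_ne {P L : Finset (ℝ × ℝ)} {e f : (ℝ × ℝ) × (ℝ × ℝ) × (ℝ × ℝ)}
    (he : e ∈ stEdges P L) (hf : f ∈ stEdges P L) (h : stCross e f) : e.1 ≠ f.1 := by
  obtain ⟨hne, x, h1, h2, h3, h4, h5⟩ := h
  exact fun h => hne (stEdges_same he hf h h1 h2 h3 h4)

theorem stSup_card {P L : Finset (ℝ × ℝ)} {e f : (ℝ × ℝ) × (ℝ × ℝ) × (ℝ × ℝ)}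
    (he : e ∈ stEdges P L) (hf : f ∈ stEdges P L) (h : stCross e f) :
    (stSup (e, f)).card = 4 := by
  have hne := stCross_ne he hf h
  obtain ⟨-, x, h1, h2, h3, h4, h5⟩ := h
  obtain ⟨⟨eL, eP, eQ⟩, e1, e2, e3, e4⟩ := mem_stEdges.1 he
  obtain ⟨⟨fL, fP, fQ⟩, f1, f2, f3, f4⟩ := mem_stEdges.1 hf
  have key : ∀ w : ℝ × ℝ, w.1 ≠ x → w.2 = e.1.1 * w.1 + e.1.2 → w.2 = f.1.1 * w.1 + f.1.2 →
      False := fun w hw a b => hne (line_eq_of_two hw (a.symm.trans b) h5)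
  have n1 : e.2.1 ≠ e.2.2 := fun h => by rw [h] at e3; exact lt_irrefl _ e3
  have n2 : f.2.1 ≠ f.2.2 := fun h => by rw [h] at f3; exact lt_irrefl _ f3
  have n3 : e.2.1 ≠ f.2.1 := fun h => key _ h1.ne e1 (by rw [h]; exact f1)
  have n4 : e.2.1 ≠ f.2.2 := fun h => key _ h1.ne e1 (by rw [h]; exact f2)
  have n5 : e.2.2 ≠ f.2.1 := fun h => key _ h2.ne' e2 (by rw [h]; exact f1)
  have n6 : e.2.2 ≠ f.2.2 := fun h => key _ h2.ne' e2 (by rw [h]; exact f2)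
  unfold stSup
  rw [Finset.card_insert_of_notMem, Finset.card_insert_of_notMem, Finset.card_insert_of_notMem,
    Finset.card_singleton]
  · simpa using n2
  · simpa using ⟨n5, n6⟩
  · simpa using ⟨n1, n3, n4⟩

noncomputable def stX (P L : Finset (ℝ × ℝ)) :
    Finset (((ℝ × ℝ) × (ℝ × ℝ) × (ℝ × ℝ)) × ((ℝ × ℝ) × (ℝ × ℝ) × (ℝ × ℝ))) :=
  (stEdges P L ×ˢ stEdges P L).filter fun c => stCross c.1 c.2

theorem mem_stX {P L : Finset (ℝ × ℝ)} {c} : c ∈ stX P L ↔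
    (c.1 ∈ stEdges P L ∧ c.2 ∈ stEdges P L) ∧ stCross c.1 c.2 := by
  simp only [stX, Finset.mem_filter, Finset.mem_product]

theorem stX_card (P L : Finset (ℝ × ℝ)) : (stX P L).card ≤ L.card ^ 2 := by
  rw [sq, ← Finset.card_product]
  refine Finset.card_le_card_of_injOn (fun c => (c.1.1, c.2.1)) ?_ ?_
  · intro c hc
    obtain ⟨⟨h1, h2⟩, -⟩ := mem_stX.1 hc
    exact Finset.mem_product.2 ⟨(mem_stEdges.1 h1).1.1, (mem_stEdges.1 h2).1.1⟩
  · intro c hc d hd hcd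
    obtain ⟨⟨c1, c2⟩, c3⟩ := mem_stX.1 hc
    obtain ⟨⟨d1, d2⟩, d3⟩ := mem_stX.1 hd
    have hne := stCross_ne c1 c2 c3
    simp only [Prod.mk.injEq] at hcd
    obtain ⟨g1, g2⟩ := hcd
    obtain ⟨-, x, x1, x2, x3, x4, x5⟩ := c3
    obtain ⟨-, y, y1, y2, y3, y4, y5⟩ := d3
    rw [← g1, ← g2] at y5
    have hxy : x = y := by
      by_contra h
      exact hne (line_eq_of_two h x5 y5)
    subst hxy
    exact Prod.ext (stEdges_same c1 d1 g1 x1 x2 y1 y2) (stEdges_same c2 d2 g2 x3 x4 y3 y4)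

theorem st_sub (P L T : Finset (ℝ × ℝ)) (hT : T ⊆ P) :
    ((stEdges P L).filter fun e => ({e.2.1, e.2.2} : Finset (ℝ × ℝ)) ⊆ T).card ≤
      3 * (P.filter fun v => ({v} : Finset (ℝ × ℝ)) ⊆ T).card +
      ((stX P L).filter fun c => stSup c ⊆ T).card := by
  set ET := (stEdges P L).filter fun e => ({e.2.1, e.2.2} : Finset (ℝ × ℝ)) ⊆ T with hET
  set XT := (stX P L).filter fun c => stSup c ⊆ T with hXT
  have hTc : (P.filter fun v => ({v} : Finset (ℝ × ℝ)) ⊆ T) = T := by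
    ext v
    simp only [Finset.mem_filter, Finset.singleton_subset_iff]
    exact ⟨fun h => h.2, fun h => ⟨hT h, h⟩⟩
  rw [hTc]
  have hmem : ∀ e ∈ ET, e ∈ stEdges P L ∧ e.2.1 ∈ T ∧ e.2.2 ∈ T := by
    intro e he
    obtain ⟨h1, h2⟩ := Finset.mem_filter.1 he
    exact ⟨h1, h2 (by simp), h2 (by simp)⟩
  have h3 : (ET \ XT.image Prod.fst).card ≤ 3 * T.card := by
    refine plane_edges (ET \ XT.image Prod.fst) T (fun e => e.1.1) (fun e => e.1.2)
      (fun e => e.2.1.1) (fun e => e.2.2.1) ?_ ?_ ?_ ?_ ?_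
    · intro e he
      exact (mem_stEdges.1 (hmem e (Finset.mem_sdiff.1 he).1).1).2.2.2.1
    · intro e he
      obtain ⟨h1, h2, h3⟩ := hmem e (Finset.mem_sdiff.1 he).1
      have := (mem_stEdges.1 h1).2.1
      show (e.2.1.1, e.1.1 * e.2.1.1 + e.1.2) ∈ T
      rw [← this]; exact h2
    · intro e he
      obtain ⟨h1, h2, h3⟩ := hmem e (Finset.mem_sdiff.1 he).1
      have := (mem_stEdges.1 h1).2.2.1
      show (e.2.2.1, e.1.1 * e.2.2.1 + e.1.2) ∈ T
      rw [← this]; exact h3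
    · intro e he w hw
      obtain ⟨h1, h2, h3⟩ := hmem e (Finset.mem_sdiff.1 he).1
      exact (mem_stEdges.1 h1).2.2.2.2 w (hT hw)
    · intro e he f hf hne x x1 x2 x3 x4 x5
      obtain ⟨h1, h2, h3⟩ := hmem e (Finset.mem_sdiff.1 he).1
      obtain ⟨k1, k2, k3⟩ := hmem f (Finset.mem_sdiff.1 hf).1
      apply (Finset.mem_sdiff.1 he).2
      refine Finset.mem_image.2 ⟨(e, f), Finset.mem_filter.2 ⟨mem_stX.2 ⟨⟨h1, k1⟩, hne, x, x1, x2,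
        x3, x4, x5⟩, ?_⟩, rfl⟩
      intro v hv
      simp only [stSup, Finset.mem_insert, Finset.mem_singleton] at hv
      rcases hv with rfl | rfl | rfl | rfl <;> assumption
  have h4 : ET.card ≤ (ET \ XT.image Prod.fst).card + (XT.image Prod.fst).card :=
    Finset.card_le_card_sdiff_add_card
  have h5 : (XT.image Prod.fst).card ≤ XT.card := Finset.card_image_le
  omega

theorem st_avg (P L : Finset (ℝ × ℝ)) (p : ℝ) (hp0 : 0 < p) (hp1 : p ≤ 1) :
    p ^ 2 * ((stEdges P L).card : ℝ) ≤ 3 * (p * P.card) + p ^ 4 * (L.card : ℝ) ^ 2 := by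
  have hE := weight_count P (stEdges P L) (fun e => ({e.2.1, e.2.2} : Finset (ℝ × ℝ))) (by
    intro e he v hv
    obtain ⟨⟨-, h1, h2⟩, -⟩ := mem_stEdges.1 he
    simp only [Finset.mem_insert, Finset.mem_singleton] at hv
    rcases hv with rfl | rfl <;> assumption) p
  have hV := weight_count P P (fun e => ({e} : Finset (ℝ × ℝ))) (by
    intro e he v hv
    rw [Finset.mem_singleton.1 hv]; exact he) p
  have hX := weight_count P (stX P L) stSup (by
    intro c hc v hv
    obtain ⟨⟨h1, h2⟩, -⟩ := mem_stX.1 hc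
    obtain ⟨⟨-, h1, h1'⟩, -⟩ := mem_stEdges.1 h1
    obtain ⟨⟨-, h2, h2'⟩, -⟩ := mem_stEdges.1 h2
    simp only [stSup, Finset.mem_insert, Finset.mem_singleton] at hv
    rcases hv with rfl | rfl | rfl | rfl <;> assumption) p
  have eE : ∑ e ∈ stEdges P L, p ^ ({e.2.1, e.2.2} : Finset (ℝ × ℝ)).card =
      p ^ 2 * ((stEdges P L).card : ℝ) := by
    rw [mul_comm, ← nsmul_eq_mul, ← Finset.sum_const]
    refine Finset.sum_congr rfl fun e he => ?_
    rw [Finset.card_pair]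
    intro h
    have := (mem_stEdges.1 he).2.2.2.1
    rw [h] at this
    exact lt_irrefl _ this
  have eV : ∑ e ∈ P, p ^ ({e} : Finset (ℝ × ℝ)).card = p * P.card := by
    simp [mul_comm]
  have eX : ∑ c ∈ stX P L, p ^ (stSup c).card = p ^ 4 * ((stX P L).card : ℝ) := by
    rw [mul_comm, ← nsmul_eq_mul, ← Finset.sum_const]
    refine Finset.sum_congr rfl fun c hc => ?_
    obtain ⟨⟨h1, h2⟩, h3⟩ := mem_stX.1 hc
    rw [show c = (c.1, c.2) from rfl, stSup_card h1 h2 h3]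
  have hXc : ((stX P L).card : ℝ) ≤ (L.card : ℝ) ^ 2 := by exact_mod_cast stX_card P L
  calc p ^ 2 * ((stEdges P L).card : ℝ) ≤ 3 * (p * P.card) + p ^ 4 * ((stX P L).card : ℝ) := by
        rw [← eE, ← eV, ← eX, ← hE, ← hV, ← hX, Finset.mul_sum, ← Finset.sum_add_distrib]
        refine Finset.sum_le_sum fun T hT => ?_
        have h := st_sub P L T (Finset.mem_powerset.1 hT)
        have h' : (((stEdges P L).filter fun e => ({e.2.1, e.2.2} : Finset (ℝ × ℝ)) ⊆ T).card : ℝ) ≤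
          3 * ((P.filter fun v => ({v} : Finset (ℝ × ℝ)) ⊆ T).card : ℝ) +
          (((stX P L).filter fun c => stSup c ⊆ T).card : ℝ) := by exact_mod_cast h
        have hw : 0 ≤ p ^ T.card * (1 - p) ^ (P \ T).card :=
          mul_nonneg (pow_nonneg hp0.le _) (pow_nonneg (by linarith) _)
        have := mul_le_mul_of_nonneg_left h' hw
        rw [mul_add, mul_left_comm _ (3 : ℝ)] at this
        convert this
    _ ≤ _ := by gcongr

theorem st_edges_bound (P L : Finset (ℝ × ℝ)) :
    ((stEdges P L).card : ℝ) ≤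
      4 * ((P.card : ℝ) ^ (2/3 : ℝ) * (L.card : ℝ) ^ (2/3 : ℝ)) + 4 * P.card := by
  rcases P.eq_empty_or_nonempty with rfl | hP
  · have h0 : stEdges ∅ L = ∅ := by
      ext e; simp [mem_stEdges]
    rw [h0]; simp
  have hm : (0 : ℝ) < P.card := by exact_mod_cast hP.card_pos
  set m : ℝ := ((P.card : ℕ) : ℝ) with hmdef
  set n : ℝ := ((L.card : ℕ) : ℝ) with hndef
  have hn0 : 0 ≤ n := by positivity
  by_cases h : n ^ 2 ≤ m
  · have := st_avg P L 1 one_pos le_rfl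
    simp only [one_pow, one_mul] at this
    have h2 : 0 ≤ m ^ (2/3 : ℝ) * n ^ (2/3 : ℝ) := by positivity
    linarith
  · rw [not_le] at h
    have hn : 0 < n := by
      rcases hn0.lt_or_eq with g | g
      · exact g
      · rw [← g] at h; norm_num at h; linarith
    -- write `m = u ^ 3`, `n = v ^ 3`
    set u := m ^ (1/3 : ℝ) with hu
    set v := n ^ (1/3 : ℝ) with hv
    have hu0 : 0 < u := by positivity
    have hv0 : 0 < v := by positivity
    have hu3 : u ^ 3 = m := by
      rw [hu, ← Real.rpow_natCast, ← Real.rpow_mul hm.le]; norm_num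
    have hv3 : v ^ 3 = n := by
      rw [hv, ← Real.rpow_natCast, ← Real.rpow_mul hn.le]; norm_num
    have hu2 : m ^ (2/3 : ℝ) = u ^ 2 := by
      rw [hu, ← Real.rpow_natCast, ← Real.rpow_mul hm.le]; norm_num
    have hv2 : n ^ (2/3 : ℝ) = v ^ 2 := by
      rw [hv, ← Real.rpow_natCast, ← Real.rpow_mul hn.le]; norm_num
    have huv : u ≤ v ^ 2 := by
      have : u ^ 3 ≤ (v ^ 2) ^ 3 := by
        rw [hu3, ← pow_mul, mul_comm 2 3, pow_mul, hv3]; exact h.le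
      exact le_of_pow_le_pow_left₀ (by norm_num) (by positivity) this
    have := st_avg P L (u / v ^ 2) (by positivity) (by rw [div_le_one (by positivity)]; exact huv)
    rw [← hmdef, ← hndef, ← hu3, ← hv3] at this
    rw [hu2, hv2]
    have h5 : (u / v ^ 2) ^ 2 * ((stEdges P L).card : ℝ) ≤ (u / v ^ 2) ^ 2 * (4 * (u ^ 2 * v ^ 2)) := by
      calc _ ≤ _ := this
        _ = _ := by field_simp; ring
    have h6 := le_of_mul_le_mul_left h5 (by positivity)
    linarith

/-- The Szemerédi–Trotter theorem for non-vertical lines in the real plane. -/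
theorem planar_st (P L : Finset (ℝ × ℝ)) :
    (((P ×ˢ L).filter fun c => c.1.2 = c.2.1 * c.1.1 + c.2.2).card : ℝ) ≤
      4 * ((P.card : ℝ) ^ (2/3 : ℝ) * (L.card : ℝ) ^ (2/3 : ℝ)) + 4 * P.card + L.card := by
  set J := (P ×ˢ L).filter fun c => c.1.2 = c.2.1 * c.1.1 + c.2.2 with hJ
  set R := J.filter (fun c => ∀ w ∈ P, w.2 = c.2.1 * w.1 + c.2.2 → w.1 ≤ c.1.1) with hR
  have hRc : R.card ≤ L.card := by
    refine Finset.card_le_card_of_injOn Prod.snd ?_ ?_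
    · intro c hc
      exact (Finset.mem_product.1 (Finset.mem_filter.1 (Finset.mem_filter.1 hc).1).1).2
    · intro c hc d hd hcd
      obtain ⟨c1, c2⟩ := Finset.mem_filter.1 hc
      obtain ⟨d1, d2⟩ := Finset.mem_filter.1 hd
      obtain ⟨c1, c3⟩ := Finset.mem_filter.1 c1
      obtain ⟨d1, d3⟩ := Finset.mem_filter.1 d1
      have hx : c.1.1 = d.1.1 := by
        refine le_antisymm (d2 _ (Finset.mem_product.1 c1).1 ?_)
          (c2 _ (Finset.mem_product.1 d1).1 ?_)
        · rw [← hcd]; exact c3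
        · rw [hcd]; exact d3
      exact Prod.ext (Prod.ext hx (by rw [c3, d3, hx, hcd])) hcd
  have hsub : J ⊆ R ∪ (stEdges P L).image (fun e => (e.2.1, e.1)) := by
    intro c hc
    rw [Finset.mem_union]
    by_cases hcR : c ∈ R
    · exact Or.inl hcR
    right
    obtain ⟨c1, c3⟩ := Finset.mem_filter.1 hc
    have hne : (P.filter fun w => w.2 = c.2.1 * w.1 + c.2.2 ∧ c.1.1 < w.1).Nonempty := by
      by_contra h
      rw [Finset.not_nonempty_iff_eq_empty, Finset.filter_eq_empty_iff] at h
      apply hcR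
      refine Finset.mem_filter.2 ⟨hc, fun w hw h1 => ?_⟩
      by_contra h2
      exact h hw ⟨h1, not_le.1 h2⟩
    obtain ⟨q, hq, hqmin⟩ := Finset.exists_min_image _ Prod.fst hne
    obtain ⟨q1, q2, q3⟩ := Finset.mem_filter.1 hq
    refine Finset.mem_image.2 ⟨(c.2, c.1, q), mem_stEdges.2 ⟨⟨(Finset.mem_product.1 c1).2,
      (Finset.mem_product.1 c1).1, q1⟩, c3, q2, q3, ?_⟩, rfl⟩
    intro w hw w1 w2 w3
    have := hqmin w (Finset.mem_filter.2 ⟨hw, w3, w1⟩)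
    exact absurd w2 (not_lt.2 this)
  have hc : J.card ≤ L.card + (stEdges P L).card :=
    calc J.card ≤ _ := Finset.card_le_card hsub
      _ ≤ R.card + ((stEdges P L).image (fun e => (e.2.1, e.1))).card := Finset.card_union_le _ _
      _ ≤ _ := add_le_add hRc Finset.card_image_le
  have hc' : (J.card : ℝ) ≤ L.card + (stEdges P L).card := by exact_mod_cast hc
  have := st_edges_bound P L
  linarith

theorem holder_third {ι : Type*} (s : Finset ι) (x y : ι → ℝ) (hx : ∀ i ∈ s, 0 ≤ x i)
    (hy : ∀ i ∈ s, 0 ≤ y i) :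
    ∑ i ∈ s, x i ^ (2/3 : ℝ) * y i ^ (1/3 : ℝ) ≤
      (∑ i ∈ s, x i) ^ (2/3 : ℝ) * (∑ i ∈ s, y i) ^ (1/3 : ℝ) := by
  have hpq : (3/2 : ℝ).HolderConjugate 3 := by
    rw [Real.holderConjugate_iff]; norm_num
  have h := Real.inner_le_Lp_mul_Lq_of_nonneg s (f := fun i => x i ^ (2/3 : ℝ))
    (g := fun i => y i ^ (1/3 : ℝ)) hpq (fun i hi => Real.rpow_nonneg (hx i hi) _)
    (fun i hi => Real.rpow_nonneg (hy i hi) _)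
  have e1 : ∑ i ∈ s, (x i ^ (2/3 : ℝ)) ^ (3/2 : ℝ) = ∑ i ∈ s, x i := by
    refine Finset.sum_congr rfl fun i hi => ?_
    rw [← Real.rpow_mul (hx i hi)]; norm_num
  have e2 : ∑ i ∈ s, (y i ^ (1/3 : ℝ)) ^ (3 : ℝ) = ∑ i ∈ s, y i := by
    refine Finset.sum_congr rfl fun i hi => ?_
    rw [← Real.rpow_mul (hy i hi)]; norm_num
  simp only [e1, e2] at h
  convert h using 3
  norm_num

/-- The point `p` lies on the line `y = l.1 x + l.2`. -/
def onLine (p l : ℝ × ℝ) : Prop := p.2 = l.1 * p.1 + l.2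

/-- Szemerédi–Trotter for lines with multiplicity at most `t`. -/
theorem weighted_st {π κ : Type*} (P : Finset π) (L : Finset κ) (ψ : π → ℝ × ℝ) (φ : κ → ℝ × ℝ)
    (t : ℕ) (hψ : ∀ p ∈ P, ∀ q ∈ P, ψ p = ψ q → p = q)
    (ht : ∀ y, (L.filter fun k => φ k = y).card ≤ t) :
    (((P ×ˢ L).filter fun c => onLine (ψ c.1) (φ c.2)).card : ℝ) ≤
      4 * ((P.card : ℝ) ^ (2/3 : ℝ) * (L.card : ℝ) ^ (2/3 : ℝ) * (t : ℝ) ^ (1/3 : ℝ)) +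
      4 * (P.card * t) + L.card := by
  set J := (P ×ˢ L).filter fun c => onLine (ψ c.1) (φ c.2) with hJ
  set rk : κ → ℕ := fun k => (L.filter fun k' => φ k' = φ k).toList.idxOf k with hrk
  have hrk_lt : ∀ k ∈ L, rk k < t := by
    intro k hk
    have : rk k < (L.filter fun k' => φ k' = φ k).toList.length := by
      rw [hrk, List.idxOf_lt_length_iff, Finset.mem_toList]
      exact Finset.mem_filter.2 ⟨hk, rfl⟩
    rw [Finset.length_toList] at this
    exact this.trans_le (ht _)
  have hrk_inj : ∀ k ∈ L, ∀ k' ∈ L, φ k = φ k' → rk k = rk k' → k = k' := by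
    intro k hk k' hk' h h'
    simp only [hrk, h] at h'
    refine (List.idxOf_inj ?_).1 h'
    rw [Finset.mem_toList]
    exact Finset.mem_filter.2 ⟨hk, h⟩
  set Lj : ℕ → Finset κ := fun j => L.filter fun k => rk k = j with hLj
  have hJsum : J.card = ∑ j ∈ Finset.range t, (J.filter fun c => rk c.2 = j).card := by
    refine Finset.card_eq_sum_card_fiberwise ?_
    intro c hc
    have := (Finset.mem_product.1 (Finset.mem_filter.1 hc).1).2
    exact Finset.mem_coe.2 (Finset.mem_range.2 (hrk_lt _ this))
  have hLsum : L.card = ∑ j ∈ Finset.range t, (Lj j).card := by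
    refine Finset.card_eq_sum_card_fiberwise ?_
    intro c hc
    exact Finset.mem_coe.2 (Finset.mem_range.2 (hrk_lt _ hc))
  have hj : ∀ j ∈ Finset.range t, ((J.filter fun c => rk c.2 = j).card : ℝ) ≤
      4 * ((P.card : ℝ) ^ (2/3 : ℝ) * ((Lj j).card : ℝ) ^ (2/3 : ℝ)) + 4 * P.card +
        (Lj j).card := by
    intro j _
    have h := planar_st (P.image ψ) ((Lj j).image φ)
    rw [Finset.card_image_of_injOn (s := P) (fun p hp q hq h => hψ p hp q hq h),
      Finset.card_image_of_injOn (s := Lj j)] at h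
    · refine le_trans ?_ h
      norm_cast
      refine Finset.card_le_card_of_injOn (fun c => (ψ c.1, φ c.2)) ?_ ?_
      · intro c hc
        obtain ⟨c1, c2⟩ := Finset.mem_filter.1 hc
        obtain ⟨c1, c3⟩ := Finset.mem_filter.1 c1
        obtain ⟨c4, c5⟩ := Finset.mem_product.1 c1
        refine Finset.mem_filter.2 ⟨Finset.mem_product.2 ⟨Finset.mem_image_of_mem _ c4,
          Finset.mem_image_of_mem _ (Finset.mem_filter.2 ⟨c5, c2⟩)⟩, c3⟩
      · intro c hc d hd hcd
        obtain ⟨c1, c2⟩ := Finset.mem_filter.1 hc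
        obtain ⟨c1, c3⟩ := Finset.mem_filter.1 c1
        obtain ⟨c4, c5⟩ := Finset.mem_product.1 c1
        obtain ⟨d1, d2⟩ := Finset.mem_filter.1 hd
        obtain ⟨d1, d3⟩ := Finset.mem_filter.1 d1
        obtain ⟨d4, d5⟩ := Finset.mem_product.1 d1
        simp only [Prod.mk.injEq] at hcd
        exact Prod.ext (hψ _ c4 _ d4 hcd.1) (hrk_inj _ c5 _ d5 hcd.2 (c2.trans d2.symm))
    · intro k hk k' hk' h
      obtain ⟨h1, h2⟩ := Finset.mem_filter.1 hk
      obtain ⟨h3, h4⟩ := Finset.mem_filter.1 hk'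
      exact hrk_inj _ h1 _ h3 h (h2.trans h4.symm)
  have hh := holder_third (Finset.range t) (fun j => ((Lj j).card : ℝ)) (fun _ => (1 : ℝ))
    (fun _ _ => by positivity) (fun _ _ => by norm_num)
  have hLs : ∑ j ∈ Finset.range t, ((Lj j).card : ℝ) = L.card := by rw [hLsum]; push_cast; rfl
  simp only [Real.one_rpow, mul_one, Finset.sum_const, Finset.card_range, nsmul_eq_mul] at hh
  rw [hLs] at hh
  calc (J.card : ℝ) = ∑ j ∈ Finset.range t, ((J.filter fun c => rk c.2 = j).card : ℝ) := by
        rw [hJsum]; push_cast; rfl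
    _ ≤ ∑ j ∈ Finset.range t, (4 * ((P.card : ℝ) ^ (2/3 : ℝ) * ((Lj j).card : ℝ) ^ (2/3 : ℝ)) +
        4 * P.card + (Lj j).card) := Finset.sum_le_sum hj
    _ = 4 * ((P.card : ℝ) ^ (2/3 : ℝ) * ∑ j ∈ Finset.range t, ((Lj j).card : ℝ) ^ (2/3 : ℝ)) +
        4 * (P.card * t) + L.card := by
        rw [Finset.sum_add_distrib, Finset.sum_add_distrib, hLs, ← Finset.mul_sum, ← Finset.mul_sum]
        simp only [Finset.sum_const, Finset.card_range, nsmul_eq_mul]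
        ring
    _ ≤ 4 * ((P.card : ℝ) ^ (2/3 : ℝ) * ((L.card : ℝ) ^ (2/3 : ℝ) * (t : ℝ) ^ (1/3 : ℝ))) +
        4 * (P.card * t) + L.card := by gcongr
    _ = _ := by ring

/-- Second-moment bound for the number of lines through the rich points. -/
theorem rich_sq {κ : Type*} (H : Finset (ℝ × ℝ)) (L : Finset κ) (φ : κ → ℝ × ℝ) (t : ℕ)
    (ht : ∀ y, (L.filter fun k => φ k = y).card ≤ t) :
    ∑ v ∈ H, (L.filter fun k => onLine v (φ k)).card ^ 2 ≤
      L.card ^ 2 + t * ∑ v ∈ H, (L.filter fun k => onLine v (φ k)).card := by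
  set N : ℝ × ℝ → Finset κ := fun v => L.filter fun k => onLine v (φ k) with hN
  set D : ℝ × ℝ → Finset (κ × κ) := fun v => (N v ×ˢ N v).filter fun c => φ c.1 ≠ φ c.2 with hD
  set Q : ℝ × ℝ → Finset (κ × κ) := fun v => (N v ×ˢ N v).filter fun c => φ c.1 = φ c.2 with hQ
  have h1 : ∀ v, (N v).card ^ 2 = (D v).card + (Q v).card := by
    intro v
    rw [sq, ← Finset.card_product, add_comm]
    exact (Finset.card_filter_add_card_filter_not _).symm
  have h2 : ∀ v, (Q v).card ≤ t * (N v).card := by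
    intro v
    refine Finset.card_le_mul_card_image_of_maps_to (f := Prod.fst) ?_ t ?_
    · intro c hc
      exact (Finset.mem_product.1 (Finset.mem_filter.1 hc).1).1
    · intro k _
      refine le_trans ?_ (ht (φ k))
      refine Finset.card_le_card_of_injOn Prod.snd ?_ ?_
      · intro c hc
        obtain ⟨c1, c2⟩ := Finset.mem_filter.1 hc
        obtain ⟨c1, c3⟩ := Finset.mem_filter.1 c1
        refine Finset.mem_filter.2 ⟨(Finset.mem_filter.1 (Finset.mem_product.1 c1).2).1, ?_⟩
        rw [← c3, c2]
      · intro c hc d hd h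
        exact Prod.ext ((Finset.mem_filter.1 hc).2.trans (Finset.mem_filter.1 hd).2.symm) h
  have h3 : ∑ v ∈ H, (D v).card ≤ L.card ^ 2 := by
    rw [← Finset.card_biUnion]
    · rw [sq, ← Finset.card_product]
      refine Finset.card_le_card ?_
      intro c hc
      obtain ⟨v, -, hc⟩ := Finset.mem_biUnion.1 hc
      obtain ⟨c1, c2⟩ := Finset.mem_product.1 (Finset.mem_filter.1 hc).1
      exact Finset.mem_product.2 ⟨(Finset.mem_filter.1 c1).1, (Finset.mem_filter.1 c2).1⟩
    · intro v _ w _ hvw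
      refine Finset.disjoint_left.2 fun c hc hd => ?_
      obtain ⟨c0, c3⟩ := Finset.mem_filter.1 hc
      obtain ⟨c1, c2⟩ := Finset.mem_product.1 c0
      obtain ⟨d1, d2⟩ := Finset.mem_product.1 (Finset.mem_filter.1 hd).1
      have v1 : v.2 = (φ c.1).1 * v.1 + (φ c.1).2 := (Finset.mem_filter.1 c1).2
      have v2 : v.2 = (φ c.2).1 * v.1 + (φ c.2).2 := (Finset.mem_filter.1 c2).2
      have w1 : w.2 = (φ c.1).1 * w.1 + (φ c.1).2 := (Finset.mem_filter.1 d1).2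
      have w2 : w.2 = (φ c.2).1 * w.1 + (φ c.2).2 := (Finset.mem_filter.1 d2).2
      have hx : v.1 = w.1 := by
        by_contra h
        exact c3 (line_eq_of_two h (v1.symm.trans v2) (w1.symm.trans w2))
      exact hvw (Prod.ext hx (by rw [v1, w1, hx]))
  calc ∑ v ∈ H, (N v).card ^ 2 = ∑ v ∈ H, (D v).card + ∑ v ∈ H, (Q v).card := by
        rw [← Finset.sum_add_distrib]; exact Finset.sum_congr rfl fun v _ => h1 v
    _ ≤ L.card ^ 2 + ∑ v ∈ H, t * (N v).card :=
        add_le_add h3 (Finset.sum_le_sum fun v _ => h2 v)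
    _ = _ := by rw [Finset.mul_sum]

set_option maxHeartbeats 800000 in
theorem double_st {π κ : Type*} (P : Finset π) (L : Finset κ) (ψ1 ψ2 : π → ℝ × ℝ)
    (φ1 φ2 : κ → ℝ × ℝ) (t : ℕ)
    (hψ : ∀ p ∈ P, ∀ q ∈ P, ψ1 p = ψ1 q → ψ2 p = ψ2 q → p = q)
    (ht1 : ∀ y, (L.filter fun k => φ1 k = y).card ≤ t)
    (ht2 : ∀ y, (L.filter fun k => φ2 k = y).card ≤ t) :
    (((P ×ˢ L).filter fun c => onLine (ψ1 c.1) (φ1 c.2) ∧ onLine (ψ2 c.1) (φ2 c.2)).card : ℝ) ≤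
      12 * ((P.card : ℝ) ^ (2/3 : ℝ) * (L.card : ℝ) ^ (2/3 : ℝ) * (t : ℝ) ^ (1/3 : ℝ)) +
      10 * (P.card * t) + L.card := by
  set J := (P ×ˢ L).filter fun c => onLine (ψ1 c.1) (φ1 c.2) ∧ onLine (ψ2 c.1) (φ2 c.2) with hJ
  set V := P.image ψ2 with hV
  set M : ℝ × ℝ → Finset π := fun v => P.filter fun p => ψ2 p = v with hM
  set N : ℝ × ℝ → Finset κ := fun v => L.filter fun k => onLine v (φ2 k) with hN
  set H := V.filter fun v => 2 * t < (N v).card with hH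
  set X : ℝ := (P.card : ℝ) ^ (2/3 : ℝ) * (L.card : ℝ) ^ (2/3 : ℝ) * (t : ℝ) ^ (1/3 : ℝ) with hX
  have hJsum : J.card = ∑ v ∈ V, (J.filter fun c => ψ2 c.1 = v).card := by
    refine Finset.card_eq_sum_card_fiberwise ?_
    intro c hc
    exact Finset.mem_image_of_mem _ (Finset.mem_product.1 (Finset.mem_filter.1 hc).1).1
  have hPsum : P.card = ∑ v ∈ V, (M v).card :=
    Finset.card_eq_sum_card_fiberwise fun c hc => Finset.mem_image_of_mem _ hc
  have hPs : ∑ v ∈ V, ((M v).card : ℝ) = P.card := by rw [hPsum]; push_cast; rfl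
  have hPsH : ∑ v ∈ H, ((M v).card : ℝ) ≤ P.card := by
    rw [← hPs]
    exact Finset.sum_le_sum_of_subset_of_nonneg (Finset.filter_subset _ _)
      (fun _ _ _ => by positivity)
  have hJv : ∀ v, (J.filter fun c => ψ2 c.1 = v) ⊆
      (M v ×ˢ N v).filter fun c => onLine (ψ1 c.1) (φ1 c.2) := by
    intro v c hc
    obtain ⟨c1, c2⟩ := Finset.mem_filter.1 hc
    obtain ⟨c1, c3, c4⟩ := Finset.mem_filter.1 c1
    obtain ⟨c5, c6⟩ := Finset.mem_product.1 c1
    refine Finset.mem_filter.2 ⟨Finset.mem_product.2 ⟨Finset.mem_filter.2 ⟨c5, c2⟩,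
      Finset.mem_filter.2 ⟨c6, ?_⟩⟩, c3⟩
    rw [← c2]; exact c4
  have hv : ∀ v ∈ V, ((J.filter fun c => ψ2 c.1 = v).card : ℝ) ≤ 2 * t * (M v).card +
      if 2 * t < (N v).card then 4 * (((M v).card : ℝ) ^ (2/3 : ℝ) * ((N v).card : ℝ) ^ (2/3 : ℝ)
        * (t : ℝ) ^ (1/3 : ℝ)) + 4 * ((M v).card * t) + (N v).card else 0 := by
    intro v _
    split_ifs with h
    · have h1 := weighted_st (M v) (N v) ψ1 φ1 t (by
        intro p hp q hq hpq
        obtain ⟨p1, p2⟩ := Finset.mem_filter.1 hp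
        obtain ⟨q1, q2⟩ := Finset.mem_filter.1 hq
        exact hψ p p1 q q1 hpq (p2.trans q2.symm)) (by
        intro y
        refine le_trans (Finset.card_le_card ?_) (ht1 y)
        exact Finset.filter_subset_filter _ (Finset.filter_subset _ _))
      have h2 : ((J.filter fun c => ψ2 c.1 = v).card : ℝ) ≤
          (((M v ×ˢ N v).filter fun c => onLine (ψ1 c.1) (φ1 c.2)).card : ℝ) := by
        exact_mod_cast Finset.card_le_card (hJv v)
      have h3 : (0 : ℝ) ≤ 2 * t * (M v).card := by positivity
      linarith
    · rw [not_lt] at h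
      have h2 : (J.filter fun c => ψ2 c.1 = v).card ≤ (M v).card * (N v).card := by
        rw [← Finset.card_product]
        exact (Finset.card_le_card (hJv v)).trans (Finset.card_filter_le _ _)
      have h3 : (J.filter fun c => ψ2 c.1 = v).card ≤ 2 * t * (M v).card := by
        refine h2.trans ?_
        rw [mul_comm]
        gcongr
      rw [add_zero]
      exact_mod_cast h3
  have hsq : ∑ v ∈ H, ((N v).card : ℝ) ^ 2 ≤ 2 * (L.card : ℝ) ^ 2 := by
    have h1 : ∑ v ∈ H, ((N v).card : ℝ) ^ 2 ≤
        (L.card : ℝ) ^ 2 + t * ∑ v ∈ H, ((N v).card : ℝ) := by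
      exact_mod_cast rich_sq H L φ2 t ht2
    have h2 : 2 * (t * ∑ v ∈ H, ((N v).card : ℝ)) ≤ ∑ v ∈ H, ((N v).card : ℝ) ^ 2 := by
      rw [Finset.mul_sum, Finset.mul_sum]
      refine Finset.sum_le_sum fun v hv => ?_
      have h3 : (2 : ℝ) * t ≤ (N v).card := by exact_mod_cast (Finset.mem_filter.1 hv).2.le
      have h4 : (0 : ℝ) ≤ (N v).card := by positivity
      nlinarith
    linarith
  have hNsum : ∑ v ∈ H, ((N v).card : ℝ) ≤ 4 * X + 4 * (P.card * t) + L.card := by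
    have h1 : ∑ v ∈ H, ((N v).card : ℝ) ≤ ∑ v ∈ V, ((N v).card : ℝ) :=
      Finset.sum_le_sum_of_subset_of_nonneg (Finset.filter_subset _ _)
        (fun _ _ _ => by positivity)
    have h2 := weighted_st V L id φ2 t (fun _ _ _ _ h => h) ht2
    have h3 : (((V ×ˢ L).filter fun c => onLine (id c.1) (φ2 c.2)).card) =
        ∑ v ∈ V, (N v).card := by
      rw [Finset.card_filter, Finset.sum_product]
      refine Finset.sum_congr rfl fun v _ => ?_
      rw [hN, Finset.card_filter]
      rfl
    rw [h3] at h2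
    push_cast at h2
    have h4 : (V.card : ℝ) ≤ P.card := by exact_mod_cast Finset.card_image_le
    refine h1.trans (h2.trans ?_)
    rw [hX]
    gcongr
  have hhold : ∑ v ∈ H, ((M v).card : ℝ) ^ (2/3 : ℝ) * ((N v).card : ℝ) ^ (2/3 : ℝ) ≤
      2 * ((P.card : ℝ) ^ (2/3 : ℝ) * (L.card : ℝ) ^ (2/3 : ℝ)) := by
    have h1 := holder_third H (fun v => ((M v).card : ℝ)) (fun v => ((N v).card : ℝ) ^ 2)
      (fun _ _ => by positivity) (fun _ _ => by positivity)
    have h2 : ∀ x : ℝ, 0 ≤ x → (x ^ 2) ^ (1/3 : ℝ) = x ^ (2/3 : ℝ) := by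
      intro x hx
      rw [← Real.rpow_natCast, ← Real.rpow_mul hx]; norm_num
    have h3 : ∑ v ∈ H, ((M v).card : ℝ) ^ (2/3 : ℝ) * ((N v).card : ℝ) ^ (2/3 : ℝ) =
        ∑ v ∈ H, ((M v).card : ℝ) ^ (2/3 : ℝ) * (((N v).card : ℝ) ^ 2) ^ (1/3 : ℝ) :=
      Finset.sum_congr rfl fun v _ => by rw [h2 _ (by positivity)]
    rw [h3]
    refine h1.trans ?_
    have h4 : (∑ v ∈ H, ((N v).card : ℝ) ^ 2) ^ (1/3 : ℝ) ≤ 2 * (L.card : ℝ) ^ (2/3 : ℝ) :=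
      calc (∑ v ∈ H, ((N v).card : ℝ) ^ 2) ^ (1/3 : ℝ) ≤ (2 * (L.card : ℝ) ^ 2) ^ (1/3 : ℝ) :=
            Real.rpow_le_rpow (Finset.sum_nonneg fun _ _ => sq_nonneg _) hsq (by norm_num)
        _ = 2 ^ (1/3 : ℝ) * (L.card : ℝ) ^ (2/3 : ℝ) := by
            rw [Real.mul_rpow (by norm_num) (sq_nonneg _), h2 _ (Nat.cast_nonneg _)]
        _ ≤ 2 * (L.card : ℝ) ^ (2/3 : ℝ) := by
            refine mul_le_mul_of_nonneg_right ?_ (Real.rpow_nonneg (Nat.cast_nonneg _) _)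
            calc (2 : ℝ) ^ (1/3 : ℝ) ≤ 2 ^ (1 : ℝ) :=
                  Real.rpow_le_rpow_of_exponent_le (by norm_num) (by norm_num)
              _ = 2 := Real.rpow_one _
    calc (∑ v ∈ H, ((M v).card : ℝ)) ^ (2/3 : ℝ) * (∑ v ∈ H, ((N v).card : ℝ) ^ 2) ^ (1/3 : ℝ)
        ≤ (P.card : ℝ) ^ (2/3 : ℝ) * (2 * (L.card : ℝ) ^ (2/3 : ℝ)) := by
          refine mul_le_mul (Real.rpow_le_rpow (Finset.sum_nonneg fun _ _ => Nat.cast_nonneg _)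
            hPsH (by norm_num)) h4 (Real.rpow_nonneg (Finset.sum_nonneg fun _ _ => sq_nonneg _) _)
            (Real.rpow_nonneg (Nat.cast_nonneg _) _)
      _ = _ := by ring
  calc (J.card : ℝ) = ∑ v ∈ V, ((J.filter fun c => ψ2 c.1 = v).card : ℝ) := by
        rw [hJsum]; push_cast; rfl
    _ ≤ _ := Finset.sum_le_sum hv
    _ = 2 * (P.card * t) + (4 * (t : ℝ) ^ (1/3 : ℝ) *
          ∑ v ∈ H, ((M v).card : ℝ) ^ (2/3 : ℝ) * ((N v).card : ℝ) ^ (2/3 : ℝ) +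
          4 * t * ∑ v ∈ H, ((M v).card : ℝ) + ∑ v ∈ H, ((N v).card : ℝ)) := by
        rw [Finset.sum_add_distrib, ← Finset.sum_filter, ← Finset.mul_sum, hPs,
          Finset.sum_add_distrib, Finset.sum_add_distrib, Finset.mul_sum, Finset.mul_sum]
        congr 1
        · ring
        congr 2
        · exact Finset.sum_congr rfl fun v _ => by ring
        · exact Finset.sum_congr rfl fun v _ => by ring
    _ ≤ 2 * (P.card * t) + (4 * (t : ℝ) ^ (1/3 : ℝ) *
          (2 * ((P.card : ℝ) ^ (2/3 : ℝ) * (L.card : ℝ) ^ (2/3 : ℝ))) +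
          4 * t * P.card + (4 * X + 4 * (P.card * t) + L.card)) := by gcongr
    _ = _ := by rw [hX]; ring

noncomputable def DoubleLine.cplus : DoubleLine → ℝ × ℝ
  | .slope a b => (a.dplus, b.dplus)
  | .vert _ => 0

noncomputable def DoubleLine.cminus : DoubleLine → ℝ × ℝ
  | .slope a b => (a.dminus, b.dminus)
  | .vert _ => 0

def DoubleLine.isSlope : DoubleLine → Prop
  | .slope _ _ => True
  | .vert _ => False

theorem DoubleNumber.ext_pm {a b : DoubleNumber} (h1 : a.dplus = b.dplus)
    (h2 : a.dminus = b.dminus) : a = b := by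
  simp only [DoubleNumber.dplus, DoubleNumber.dminus] at h1 h2
  exact DoubleNumber.ext (by linarith) (by linarith)

theorem DoubleLine.mem_slope (l : DoubleLine) (hl : l.isSlope) (p : DoubleNumber × DoubleNumber)
    (h : p ∈ l.pts) : onLine (p.1.dplus, p.2.dplus) l.cplus ∧
      onLine (p.1.dminus, p.2.dminus) l.cminus := by
  cases l with
  | vert b => exact hl.elim
  | slope a b =>
    have h' : p.2 = a * p.1 + b := h
    have hre : p.2.re = (a.re * p.1.re + a.im * p.1.im) + b.re := by rw [h']; rfl
    have him : p.2.im = (a.re * p.1.im + a.im * p.1.re) + b.im := by rw [h']; rfl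
    constructor
    · simp only [onLine, DoubleLine.cplus, DoubleNumber.dplus]
      rw [hre, him]; ring
    · simp only [onLine, DoubleLine.cminus, DoubleNumber.dminus]
      rw [hre, him]; ring

/-- **Szemerédi–Trotter-type bound in the double plane.**
For `0 ≤ α ≤ 1` and `ρ > 0` there is `C > 0` such that for every finite set `𝒫` of `m` points
and every finite set `ℒ` of `n` lines in `𝕊²` in which, for every `r ∈ ℝ`, at most `n^α` lines
of the form `y = a x + b` have `Δ⁺(a) = r` and at most `n^α` such lines have `Δ⁻(a) = r`,
we have `I(𝒫,ℒ) ≤ C (m^(2/3+ρ) n^((2+α)/3) + m n^α + n)`. -/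
theorem double_szemeredi_trotter (α ρ : ℝ) (hα0 : 0 ≤ α) (hα1 : α ≤ 1) (hρ : 0 < ρ) :
    ∃ C : ℝ, 0 < C ∧ ∀ (P : Finset (DoubleNumber × DoubleNumber)) (L : Finset DoubleLine),
      (∀ r : ℝ, ((L.filter fun l => l.slopeDplus = some r).card : ℝ) ≤ (L.card : ℝ) ^ α ∧
                ((L.filter fun l => l.slopeDminus = some r).card : ℝ) ≤ (L.card : ℝ) ^ α) →
      (inc P L : ℝ) ≤ C * ((P.card : ℝ) ^ (2/3 + ρ) * (L.card : ℝ) ^ ((2 + α)/3)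
        + (P.card : ℝ) * (L.card : ℝ) ^ α + (L.card : ℝ)) := by
  refine ⟨12, by norm_num, fun P L hL => ?_⟩
  rcases L.eq_empty_or_nonempty with rfl | hLne
  · have h0 : inc P ∅ = 0 := by simp [inc]
    rw [h0, Nat.cast_zero]
    positivity
  rcases P.eq_empty_or_nonempty with rfl | hPne
  · have h0 : inc ∅ L = 0 := by simp [inc]
    rw [h0, Nat.cast_zero]
    positivity
  have hn : (1 : ℝ) ≤ L.card := by exact_mod_cast hLne.card_pos
  have hm : (1 : ℝ) ≤ P.card := by exact_mod_cast hPne.card_pos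
  set t : ℕ := ⌊(L.card : ℝ) ^ α⌋₊ with ht
  have htle : (t : ℝ) ≤ (L.card : ℝ) ^ α := Nat.floor_le (by positivity)
  set L' := L.filter (fun l => l.isSlope) with hL'
  have hn' : (L'.card : ℝ) ≤ L.card := by exact_mod_cast Finset.card_filter_le _ _
  have hd := double_st P L' (fun p => (p.1.dplus, p.2.dplus)) (fun p => (p.1.dminus, p.2.dminus))
    DoubleLine.cplus DoubleLine.cminus t (by
      intro p _ q _ h1 h2
      simp only [Prod.mk.injEq] at h1 h2
      exact Prod.ext (DoubleNumber.ext_pm h1.1 h2.1) (DoubleNumber.ext_pm h1.2 h2.2)) (by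
      intro y
      refine le_trans (Finset.card_le_card ?_) (Nat.le_floor (hL y.1).1)
      intro l hl
      obtain ⟨h1, h2⟩ := Finset.mem_filter.1 hl
      obtain ⟨h1, h3⟩ := Finset.mem_filter.1 h1
      refine Finset.mem_filter.2 ⟨h1, ?_⟩
      cases l with
      | vert b => exact h3.elim
      | slope a b => rw [← h2]; rfl) (by
      intro y
      refine le_trans (Finset.card_le_card ?_) (Nat.le_floor (hL y.1).2)
      intro l hl
      obtain ⟨h1, h2⟩ := Finset.mem_filter.1 hl
      obtain ⟨h1, h3⟩ := Finset.mem_filter.1 h1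
      refine Finset.mem_filter.2 ⟨h1, ?_⟩
      cases l with
      | vert b => exact h3.elim
      | slope a b => rw [← h2]; rfl)
  set J := (P ×ˢ L').filter fun c => onLine (c.1.1.dplus, c.1.2.dplus) c.2.cplus ∧
    onLine (c.1.1.dminus, c.1.2.dminus) c.2.cminus with hJ
  set I := (P ×ˢ L).filter fun pl => pl.1 ∈ pl.2.pts with hI
  set W := I.filter (fun c => ¬ c.2.isSlope) with hW
  have hWc : W.card ≤ P.card := by
    refine Finset.card_le_card_of_injOn Prod.fst ?_ ?_
    · intro c hc
      exact (Finset.mem_product.1 (Finset.mem_filter.1 (Finset.mem_filter.1 hc).1).1).1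
    · rintro ⟨p, l⟩ hc ⟨q, k⟩ hd hcd
      obtain ⟨c1, c2⟩ := Finset.mem_filter.1 hc
      obtain ⟨d1, d2⟩ := Finset.mem_filter.1 hd
      have c3 := (Finset.mem_filter.1 c1).2
      have d3 := (Finset.mem_filter.1 d1).2
      have hpq : p = q := hcd
      subst hpq
      cases l with
      | slope a b => exact absurd trivial c2
      | vert b =>
        cases k with
        | slope a' b' => exact absurd trivial d2
        | vert b' =>
          have e1 : p.1 = b := c3
          have e2 : p.1 = b' := d3
          rw [← e1, ← e2]
  have hsub : I ⊆ J ∪ W := by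
    intro c hc
    rw [Finset.mem_union]
    by_cases h : c.2.isSlope
    · left
      obtain ⟨c1, c2⟩ := Finset.mem_filter.1 hc
      obtain ⟨c3, c4⟩ := Finset.mem_product.1 c1
      exact Finset.mem_filter.2 ⟨Finset.mem_product.2 ⟨c3, Finset.mem_filter.2 ⟨c4, h⟩⟩,
        DoubleLine.mem_slope _ h _ c2⟩
    · exact Or.inr (Finset.mem_filter.2 ⟨hc, h⟩)
  have hIc : (inc P L : ℝ) ≤ J.card + P.card := by
    have : I.card ≤ J.card + P.card :=
      (Finset.card_le_card hsub).trans ((Finset.card_union_le _ _).trans (by omega))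
    exact_mod_cast this
  have hX : (P.card : ℝ) ^ (2/3 : ℝ) * (L'.card : ℝ) ^ (2/3 : ℝ) * (t : ℝ) ^ (1/3 : ℝ) ≤
      (P.card : ℝ) ^ (2/3 + ρ) * (L.card : ℝ) ^ ((2 + α)/3) := by
    have e : (L.card : ℝ) ^ ((2 + α)/3) =
        (L.card : ℝ) ^ (2/3 : ℝ) * ((L.card : ℝ) ^ α) ^ (1/3 : ℝ) := by
      rw [← Real.rpow_mul (by positivity), ← Real.rpow_add (by positivity)]
      congr 1; ring
    rw [e, ← mul_assoc]
    have h1 : (P.card : ℝ) ^ (2/3 : ℝ) ≤ (P.card : ℝ) ^ (2/3 + ρ) :=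
      Real.rpow_le_rpow_of_exponent_le hm (by linarith)
    gcongr
  have hα : (1 : ℝ) ≤ (L.card : ℝ) ^ α := Real.one_le_rpow hn hα0
  have h5 : (P.card : ℝ) * t ≤ P.card * (L.card : ℝ) ^ α := by gcongr
  have h6 : (P.card : ℝ) ≤ P.card * (L.card : ℝ) ^ α := le_mul_of_one_le_right (by positivity) hα
  linarith
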